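/- Let S₁=(X_α,p_α^β,A) and S₂=(Y_α,q_α^β,A) be two ω-inverse systems of compact Hausdorff spaces over the same directed index set A, and let f be a continuous map from lim S₁ to lim S₂. If for every α∈A the projection p_α: lim S₁→X_α is surjective, then there exist a cofinal closed subset B of A and a morphism (f_α)_{α∈B} from S₁|B to S₂|B whose limit is f (i.e., continuous maps f_α: X_α→Y_α with f_α∘p_α^β=q_α^β∘f_β for α≤β in B, and lim(f_α)=f). -/

import Mathlib

universe u v w

noncomputable section

/-! ### Inverse systems and ω-systems -/

/-- An inverse system of topological spaces over a directed preorder `A`. -/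
structure InvSys (A : Type u) [Preorder A] : Type (u + 1) where
  X : A → Type u
  top : ∀ a, TopologicalSpace (X a)
  p : ∀ {a b : A}, a ≤ b → X b → X a
  p_cont : ∀ {a b : A} (h : a ≤ b), @Continuous (X b) (X a) (top b) (top a) (p h)
  p_id : ∀ (a : A) (x : X a), p (le_refl a) x = x
  p_comp : ∀ {a b c : A} (h₁ : a ≤ b) (h₂ : b ≤ c) (x : X c),
    p h₁ (p h₂ x) = p (h₁.trans h₂) x

attribute [instance] InvSys.top

variable {A : Type u} [Preorder A]

/-- The inverse limit of the restriction of an inverse system to a subset of indices. -/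
def InvSys.limOn (S : InvSys A) (B : Set A) : Type u :=
  {u : ∀ b : ↥B, S.X b // ∀ (b c : ↥B) (h : (b : A) ≤ (c : A)), S.p h (u c) = u b}

instance (S : InvSys A) (B : Set A) : TopologicalSpace (S.limOn B) :=
  inferInstanceAs (TopologicalSpace {u : ∀ b : ↥B, S.X b // _})

/-- The inverse limit of an inverse system. -/
def InvSys.lim (S : InvSys A) : Type u :=
  {u : ∀ a : A, S.X a // ∀ (a b : A) (h : a ≤ b), S.p h (u b) = u a}

instance (S : InvSys A) : TopologicalSpace S.lim :=
  inferInstanceAs (TopologicalSpace {u : ∀ a : A, S.X a // _})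

/-- The projection of the inverse limit to a term of the system. -/
def InvSys.proj (S : InvSys A) (a : A) : S.lim → S.X a :=
  fun u => u.1 a

/-- The projection, as a continuous map. -/
def InvSys.projMap (S : InvSys A) (a : A) : C(S.lim, S.X a) :=
  ⟨S.proj a, (continuous_apply a).comp continuous_subtype_val⟩

/-- `S` is an ω-system: every nonempty countable chain of indices has a supremum, the
term at the supremum of a chain of indices is canonically homeomorphic to the inverse
limit of the corresponding subsystem, and all spaces are second countable. -/
def InvSys.IsOmega (S : InvSys A) : Prop :=
  (∀ C : Set A, C.Nonempty → C.Countable → IsChain (· ≤ ·) C → ∃ β : A, IsLUB C β) ∧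
  (∀ (B : Set A) (β : A), B.Nonempty → IsChain (· ≤ ·) B → ∀ hβ : IsLUB B β,
    IsHomeomorph (fun x : S.X β =>
      (⟨fun b => S.p (hβ.1 b.2) x, fun _ _ _ => S.p_comp _ _ x⟩ : S.limOn B))) ∧
  (∀ a : A, SecondCountableTopology (S.X a))

/-- `B` is cofinal in `A`. -/
def SetCofinal {A : Type u} [Preorder A] (B : Set A) : Prop :=
  ∀ a : A, ∃ b ∈ B, a ≤ b

/-- `B` is closed in `A` (under suprema of chains). -/
def SetClosedUnderSups {A : Type u} [Preorder A] (B : Set A) : Prop :=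
  ∀ C ⊆ B, C.Nonempty → IsChain (· ≤ ·) C → ∀ β : A, IsLUB C β → β ∈ B

end

/-- In a directed preorder, a relation with arbitrarily large successors has an increasing
sequence of successors starting at any given point. -/
theorem exists_monotone_seq_of_forall_exists {A : Type u} [Preorder A] (r : ℕ → A → A → Prop)
    (h : ∀ n a, ∃ a', a ≤ a' ∧ r n a a') (a : A) :
    ∃ s : ℕ → A, s 0 = a ∧ Monotone s ∧ ∀ n, r n (s n) (s (n + 1)) := by
  choose next hle hr using h
  exact ⟨fun n => Nat.rec a next n, rfl, monotone_nat_of_le_succ fun n => hle n _,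
    fun n => hr n _⟩

/-- A directed preorder in which countable chains have suprema is countably directed. -/
theorem bddAbove_of_countable_of_exists_isLUB {A : Type u} [Preorder A] [IsDirected A (· ≤ ·)]
    [Nonempty A]
    (h : ∀ C : Set A, C.Nonempty → C.Countable → IsChain (· ≤ ·) C → ∃ β : A, IsLUB C β)
    {D : Set A} (hD : D.Countable) : BddAbove D := by
  obtain rfl | hne := D.eq_empty_or_nonempty
  · exact bddAbove_empty
  obtain ⟨d, rfl⟩ := hD.exists_eq_range hne
  obtain ⟨s, -, hs, hds⟩ := exists_monotone_seq_of_forall_exists (fun n _ a' => d n ≤ a')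
    (fun n a => exists_ge_ge a (d n)) (d 0)
  obtain ⟨β, hβ⟩ := h (Set.range s) (Set.range_nonempty s) (Set.countable_range s)
    hs.isChain_range
  exact ⟨β, Set.forall_mem_range.2 fun n => (hds n).trans (hβ.1 ⟨n + 1, rfl⟩)⟩

namespace InvSys

variable {A : Type u} [Preorder A]

theorem p_proj (S : InvSys A) {a b : A} (h : a ≤ b) (u : S.lim) :
    S.p h (S.proj b u) = S.proj a u :=
  u.2 a b h

theorem continuous_proj (S : InvSys A) (a : A) : Continuous (S.proj a) :=
  (S.projMap a).continuous

theorem proj_eq_of_le (S : InvSys A) {a b : A} (h : a ≤ b) {u v : S.lim}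
    (huv : S.proj b u = S.proj b v) : S.proj a u = S.proj a v := by
  rw [← S.p_proj h u, ← S.p_proj h v, huv]

theorem compactSpace_lim (S : InvSys A) (hc : ∀ a, CompactSpace (S.X a))
    (ht : ∀ a, T2Space (S.X a)) : CompactSpace S.lim := by
  refine isCompact_iff_compactSpace.1 (IsClosed.isCompact ?_)
  change IsClosed {u : ∀ a, S.X a | ∀ (a b : A) (h : a ≤ b), S.p h (u b) = u a}
  simp only [Set.ofPred_forall]
  exact isClosed_iInter fun a => isClosed_iInter fun b => isClosed_iInter fun h =>
    isClosed_eq ((S.p_cont h).comp (continuous_apply b)) (continuous_apply a)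

/-- At the supremum of a chain, points of the limit of an ω-system are determined by their
coordinates along the chain. -/
theorem IsOmega.proj_eq_of_isLUB {S : InvSys A} (hS : S.IsOmega) {C : Set A} (hne : C.Nonempty)
    (hC : IsChain (· ≤ ·) C) {β : A} (hβ : IsLUB C β) {u v : S.lim}
    (huv : ∀ c ∈ C, S.proj c u = S.proj c v) : S.proj β u = S.proj β v := by
  refine (hS.2.1 C β hne hC hβ).injective (Subtype.ext (funext fun c => ?_))
  change S.p (hβ.1 c.2) (S.proj β u) = S.p (hβ.1 c.2) (S.proj β v)
  rw [S.p_proj, S.p_proj, huv c c.2]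

/-- A continuous map from the limit to a second countable compact Hausdorff space is determined by
a single coordinate, which may be taken arbitrarily large. -/
theorem exists_ge_forall_eq_of_proj_eq [IsDirected A (· ≤ ·)] (S : InvSys A)
    (hsup : ∀ C : Set A, C.Nonempty → C.Countable → IsChain (· ≤ ·) C → ∃ β : A, IsLUB C β)
    (hc : ∀ a, CompactSpace (S.X a)) (ht : ∀ a, T2Space (S.X a))
    {Y : Type v} [TopologicalSpace Y] [CompactSpace Y] [T2Space Y] [SecondCountableTopology Y]
    {h : S.lim → Y} (hh : Continuous h) (a : A) :
    ∃ b, a ≤ b ∧ ∀ u v, S.proj b u = S.proj b v → h u = h v := by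
  have := S.compactSpace_lim hc ht
  have : Nonempty A := ⟨a⟩
  have hopen : IsOpen ((Set.diagonal Y)ᶜ) := isClosed_diagonal.isOpen_compl
  have key : ∀ z : Y × Y, ∃ (N : Set (Y × Y)) (b : A), z ∈ (Set.diagonal Y)ᶜ →
      N ∈ nhds z ∧ ∀ u v, (h u, h v) ∈ N → S.proj b u ≠ S.proj b v := by
    intro z
    by_cases hz : z ∈ (Set.diagonal Y)ᶜ
    swap
    · exact ⟨∅, a, fun hz' => absurd hz' hz⟩
    obtain ⟨N, hNz, hNc, hNs⟩ := exists_mem_nhds_isClosed_subset (hopen.mem_nhds hz)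
    have hK : IsCompact {w : S.lim × S.lim | (h w.1, h w.2) ∈ N} :=
      (hNc.preimage (by fun_prop : Continuous fun w : S.lim × S.lim => (h w.1, h w.2))).isCompact
    obtain ⟨b, hb⟩ := hK.elim_directed_cover
      (fun b => {w : S.lim × S.lim | S.proj b w.1 ≠ S.proj b w.2})
      (fun b => isOpen_ne_fun ((S.continuous_proj b).comp continuous_fst)
        ((S.continuous_proj b).comp continuous_snd))
      (by
        rintro ⟨u, v⟩ huv
        by_contra hcon
        simp only [Set.mem_iUnion, Set.mem_ofPred_eq, not_exists, not_not] at hcon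
        obtain rfl : u = v := Subtype.ext (funext hcon)
        exact hNs huv rfl)
      (by
        intro b c
        obtain ⟨d, hbd, hcd⟩ := exists_ge_ge b c
        exact ⟨d, fun w hw heq => hw (S.proj_eq_of_le hbd heq),
          fun w hw heq => hw (S.proj_eq_of_le hcd heq)⟩)
    exact ⟨N, b, fun _ => ⟨hNz, fun u v huv => hb (show (u, v) ∈ _ from huv)⟩⟩
  choose N b hNb using key
  obtain ⟨t, hts, htc, htcov⟩ := TopologicalSpace.countable_cover_nhdsWithin
    (f := N) (s := (Set.diagonal Y)ᶜ) fun z hz => mem_nhdsWithin_of_mem_nhds (hNb z hz).1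
  obtain ⟨c, hcb⟩ := bddAbove_of_countable_of_exists_isLUB hsup ((htc.image b).insert a)
  refine ⟨c, hcb (Set.mem_insert _ _), fun u v huv => ?_⟩
  by_contra hne
  obtain ⟨z, hz, hzN⟩ := Set.mem_iUnion₂.1 (htcov (show (h u, h v) ∈ (Set.diagonal Y)ᶜ from hne))
  exact (hNb z (hts hz)).2 u v hzN
    (S.proj_eq_of_le (hcb (Set.mem_insert_of_mem _ ⟨z, hz, rfl⟩)) huv)

end InvSys

/-- **Lemma 5.** Let `S₁` and `S₂` be two ω-systems of compact Hausdorff spaces over the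
same directed index set `A` and `f` a continuous map `lim S₁ → lim S₂`.  If all the
projections of `lim S₁` are surjective, there are a cofinal closed subset `B` of `A` and
a morphism `(g_b)_{b ∈ B}` of the restricted systems whose limit is `f`. -/
theorem omega_system_limit_map (A : Type u) [PartialOrder A] [IsDirected A (· ≤ ·)]
    (S₁ S₂ : InvSys A) (h₁ : S₁.IsOmega) (h₂ : S₂.IsOmega)
    (hcpt₁ : ∀ a, CompactSpace (S₁.X a) ∧ T2Space (S₁.X a))
    (hcpt₂ : ∀ a, CompactSpace (S₂.X a) ∧ T2Space (S₂.X a))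
    (f : S₁.lim → S₂.lim) (hf : Continuous f)
    (hsurj : ∀ a, Function.Surjective (S₁.proj a)) :
    ∃ B : Set A, SetCofinal B ∧ SetClosedUnderSups B ∧
      ∃ g : ∀ b : ↥B, S₁.X b → S₂.X b,
        (∀ b : ↥B, Continuous (g b)) ∧
        (∀ (b c : ↥B) (h : (b : A) ≤ (c : A)) (x : S₁.X c),
          g b (S₁.p h x) = S₂.p h (g c x)) ∧
        (∀ (u : S₁.lim) (b : ↥B), S₂.proj b (f u) = g b (S₁.proj b u)) := by
  have hX : CompactSpace S₁.lim :=
    S₁.compactSpace_lim (fun a => (hcpt₁ a).1) fun a => (hcpt₁ a).2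
  have hT2 : ∀ a, T2Space (S₁.X a) := fun a => (hcpt₁ a).2
  have hquot : ∀ a, Topology.IsQuotientMap (S₁.proj a) := fun a =>
    (S₁.continuous_proj a).isClosedMap.isQuotientMap (S₁.continuous_proj a) (hsurj a)
  let B : Set A := {b | ∀ u v, S₁.proj b u = S₁.proj b v → S₂.proj b (f u) = S₂.proj b (f v)}
  have hcomp : ∀ (b : ↥B) u, S₂.proj b (f (Function.surjInv (hsurj b) (S₁.proj b u))) =
      S₂.proj b (f u) := fun b u => b.2 _ _ (Function.surjInv_eq (hsurj b) _)
  refine ⟨B, fun a => ?_, ?_, fun b x => S₂.proj b (f (Function.surjInv (hsurj b) x)),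
    fun b => ?_, fun b c h x => ?_, fun u b => (hcomp b u).symm⟩
  · have hstep : ∀ (_ : ℕ) a, ∃ a', a ≤ a' ∧
        ∀ u v, S₁.proj a' u = S₁.proj a' v → S₂.proj a (f u) = S₂.proj a (f v) := by
      intro _ a
      have := (hcpt₂ a).1
      have := (hcpt₂ a).2
      have := h₂.2.2 a
      exact S₁.exists_ge_forall_eq_of_proj_eq h₁.1 (fun a => (hcpt₁ a).1) hT2
        ((S₂.continuous_proj a).comp hf) a
    obtain ⟨s, rfl, hs, hsf⟩ := exists_monotone_seq_of_forall_exists _ hstep a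
    obtain ⟨β, hβ⟩ := h₁.1 (Set.range s) (Set.range_nonempty s) (Set.countable_range s)
      hs.isChain_range
    refine ⟨β, fun u v huv => ?_, hβ.1 ⟨0, rfl⟩⟩
    exact h₂.proj_eq_of_isLUB (Set.range_nonempty s) hs.isChain_range hβ
      (Set.forall_mem_range.2 fun n =>
        hsf n u v (S₁.proj_eq_of_le (hβ.1 ⟨n + 1, rfl⟩) huv))
  · intro C hCB hne hC β hβ u v huv
    exact h₂.proj_eq_of_isLUB hne hC hβ fun c hc =>
      hCB hc u v (S₁.proj_eq_of_le (hβ.1 hc) huv)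
  · rw [(hquot b).continuous_iff]
    exact ((S₂.continuous_proj b).comp hf).congr fun u => (hcomp b u).symm
  · obtain ⟨u, rfl⟩ := hsurj c x
    simp only [S₁.p_proj, hcomp, S₂.p_proj]
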